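/- Fix a nonnegative integer s and δ ∈ {0,1}. Let n be an odd positive integer with n > (2s+4)². Then Φ_n^{−(s+2)} · d_n^{2s+4−i} · ρ_{n,i} ∈ ℤ for all 1 ≤ i ≤ 2s+4. Moreover, for every positive integer n (without parity or size restriction), d_n^{s+2−i} · σ_{n,i} ∈ ℤ for all 1 ≤ i ≤ s+2. -/

import Mathlib

open Filter Finset

/-- Pochhammer symbol `(α)_k = α (α+1) ⋯ (α+k-1)` for rational `α`. -/
def poch (α : ℚ) (k : ℕ) : ℚ := ∏ i ∈ Finset.range k, (α + i)

/-- The rational function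
`A_n(t) = 2^{(6s+12)n} (4t+2n)^δ (t+1/4)_n^{s+2} (t+3/4)_n^{s+2} / (t)_{n+1}^{2s+4}`. -/
def Afun (s δ n : ℕ) (t : ℚ) : ℚ :=
  2 ^ ((6 * s + 12) * n) * (4 * t + 2 * n) ^ δ *
    poch (t + 1/4) n ^ (s + 2) * poch (t + 3/4) n ^ (s + 2) / poch t (n + 1) ^ (2 * s + 4)

/-- The rational function `B_n(t) = 2^{(3s+6)n} (t+3/4)_n^{s+2} / (t)_{n+1}^{s+2}`. -/
def Bfun (s n : ℕ) (t : ℚ) : ℚ :=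
  2 ^ ((3 * s + 6) * n) * poch (t + 3/4) n ^ (s + 2) / poch t (n + 1) ^ (s + 2)

/-- `dlcm n = lcm(1, 2, …, n)`. -/
def dlcm (n : ℕ) : ℕ := (Finset.Icc 1 n).lcm id

open scoped Classical in
/-- `Phi n` is the product of all primes `q` with `√(10 n) < q ≤ n` and `{n/q} > 1/2`. -/
noncomputable def Phi (n : ℕ) : ℕ :=
  ∏ q ∈ Finset.Icc 1 n,
    if q.Prime ∧ Real.sqrt (10 * n) < (q : ℝ) ∧ 1/2 < Int.fract ((n : ℝ) / q) then q else 1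


/-- Power series `f` over `ℚ` such that `d^j * coeff j f` lies in the subring `R`. -/
def scaledSubring (R : Subring ℚ) (d : ℚ) : Subring (PowerSeries ℚ) where
  carrier := {f | PowerSeries.rescale d f ∈ (PowerSeries.map R.subtype).range}
  mul_mem' := by
    intro a b ha hb
    simp only [Set.mem_ofPred_eq, map_mul] at *
    exact mul_mem ha hb
  one_mem' := by simp only [Set.mem_ofPred_eq, map_one]; exact one_mem _
  add_mem' := by
    intro a b ha hb
    simp only [Set.mem_ofPred_eq, map_add] at *
    exact add_mem ha hb
  zero_mem' := by simp only [Set.mem_ofPred_eq, map_zero]; exact zero_mem _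
  neg_mem' := by
    intro a ha
    simp only [Set.mem_ofPred_eq, map_neg] at *
    exact neg_mem ha

lemma mem_scaled {R : Subring ℚ} {d : ℚ} {f : PowerSeries ℚ} :
    f ∈ scaledSubring R d ↔ ∀ j, d ^ j * PowerSeries.coeff j f ∈ R := by
  constructor
  · rintro ⟨g, hg⟩ j
    have := congrArg (PowerSeries.coeff j) hg
    rw [PowerSeries.coeff_rescale, PowerSeries.coeff_map] at this
    rw [← this]
    exact (PowerSeries.coeff j g).2
  · intro h
    refine ⟨PowerSeries.mk fun j => ⟨_, h j⟩, ?_⟩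
    ext j
    rw [PowerSeries.coeff_rescale, PowerSeries.coeff_map, PowerSeries.coeff_mk]
    rfl

lemma scaled_C {R : Subring ℚ} {d c : ℚ} (hc : c ∈ R) :
    PowerSeries.C c ∈ scaledSubring R d := by
  rw [mem_scaled]
  intro j
  rw [PowerSeries.coeff_C]
  split_ifs with h
  · simpa [h] using hc
  · simp

lemma scaled_CX {R : Subring ℚ} {d c : ℚ} (hc : d * c ∈ R) :
    PowerSeries.C c * PowerSeries.X ∈ scaledSubring R d := by
  rw [mem_scaled]
  intro j
  rw [PowerSeries.coeff_C_mul, PowerSeries.coeff_X]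
  split_ifs with h
  · simpa [h] using hc
  · simp

lemma scaled_inv {R : Subring ℚ} {d c : ℚ} (hc : d * c ∈ R) :
    (1 + PowerSeries.C c * PowerSeries.X)⁻¹ ∈ scaledSubring R d := by
  have key : (1 + PowerSeries.C c * PowerSeries.X)⁻¹ = PowerSeries.mk fun j => (-c) ^ j := by
    symm
    rw [PowerSeries.eq_inv_iff_mul_eq_one (by simp)]
    ext j
    rw [mul_add, mul_one, map_add, PowerSeries.coeff_mk, PowerSeries.coeff_one, ← mul_assoc]
    cases j with
    | zero => simp
    | succ j =>
      rw [PowerSeries.coeff_succ_mul_X, PowerSeries.coeff_mul_C, PowerSeries.coeff_mk]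
      simp; ring
  rw [key, mem_scaled]
  intro j
  rw [PowerSeries.coeff_mk, ← mul_pow, mul_neg]
  exact pow_mem (neg_mem hc) j

/-- the factors of the denominator away from `-k` -/
noncomputable def Dk (n k : ℕ) : PowerSeries ℚ :=
  ∏ l ∈ (Finset.range (n + 1)).erase k, (PowerSeries.X + PowerSeries.C ((l : ℚ) - k))

lemma Dk_const (n k : ℕ) : PowerSeries.constantCoeff (Dk n k) ≠ 0 := by
  unfold Dk
  rw [map_prod, Finset.prod_ne_zero_iff]
  intro l hl
  have : (l : ℚ) ≠ k := by exact_mod_cast (Finset.mem_erase.1 hl).1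
  simpa [sub_eq_zero] using this

lemma coeff_extract (n m : ℕ) (N : Polynomial ℚ) (a : ℕ → ℕ → ℚ)
    (h : ∀ t : ℚ, (∀ k : ℕ, k ≤ n → t + (k : ℚ) ≠ 0) →
      N.eval t / poch t (n + 1) ^ m = ∑ i ∈ Finset.Icc 1 m, ∑ k ∈ Finset.range (n + 1),
            a i k / (t + (k : ℚ)) ^ i) (k : ℕ) (hk : k ≤ n) (U : PowerSeries ℚ)
    (hU : U * Dk n k ^ m = ((N.comp (Polynomial.X - Polynomial.C (k : ℚ)) : Polynomial ℚ) : PowerSeries ℚ))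
    (i : ℕ) (hi : 1 ≤ i) (him : i ≤ m) : PowerSeries.coeff (m - i) U = a i k := by
  have hN : N = ∑ i ∈ Finset.Icc 1 m, ∑ k ∈ Finset.range (n + 1),
      Polynomial.C (a i k) * (Polynomial.X + Polynomial.C (k : ℚ)) ^ (m - i) *
        (∏ l ∈ (Finset.range (n + 1)).erase k, (Polynomial.X + Polynomial.C (l : ℚ))) ^ m := by
    apply Polynomial.eq_of_infinite_eval_eq
    apply (Set.Ioi_infinite (0 : ℚ)).mono
    intro t ht
    have ht : 0 < t := ht
    have hne : ∀ k : ℕ, t + (k : ℚ) ≠ 0 := fun k => by positivity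
    have h1 := h t (fun k _ => hne k)
    have hp : poch t (n + 1) ≠ 0 := Finset.prod_ne_zero_iff.2 fun k _ => hne k
    rw [div_eq_iff (pow_ne_zero _ hp)] at h1
    simp only [Set.mem_ofPred_eq]
    rw [h1, Polynomial.eval_finsetSum, Finset.sum_mul]
    refine Finset.sum_congr rfl fun i hi => ?_
    rw [Polynomial.eval_finsetSum, Finset.sum_mul]
    refine Finset.sum_congr rfl fun k hk => ?_
    simp only [Polynomial.eval_mul, Polynomial.eval_pow, Polynomial.eval_add, Polynomial.eval_C,
      Polynomial.eval_X, Polynomial.eval_prod]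
    have : poch t (n + 1) = (t + k) * ∏ l ∈ (Finset.range (n + 1)).erase k, (t + (l : ℚ)) :=
      (Finset.mul_prod_erase _ _ hk).symm
    have hi := (Finset.mem_Icc.1 hi).2
    rw [this, mul_pow]
    have h3 : (t + (k : ℚ)) ^ m = (t + k) ^ (m - i) * (t + k) ^ i := by
      rw [← pow_add, Nat.sub_add_cancel hi]
    rw [h3]
    field_simp [hne k]
  have hcomp : ((N.comp (Polynomial.X - Polynomial.C (k : ℚ)) : Polynomial ℚ) : PowerSeries ℚ) =
      ∑ i ∈ Finset.Icc 1 m, ∑ l ∈ Finset.range (n + 1),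
      PowerSeries.C (a i l) * (PowerSeries.X + PowerSeries.C ((l : ℚ) - k)) ^ (m - i) *
        (∏ l' ∈ (Finset.range (n + 1)).erase l, (PowerSeries.X + PowerSeries.C ((l' : ℚ) - k))) ^ m := by
    have hlin : ∀ l : ℕ, (((Polynomial.X - Polynomial.C (k : ℚ)) + Polynomial.C (l : ℚ) : Polynomial ℚ) : PowerSeries ℚ)
        = PowerSeries.X + PowerSeries.C ((l : ℚ) - k) := by
      intro l
      rw [Polynomial.coe_add, Polynomial.coe_sub, Polynomial.coe_X, Polynomial.coe_C, Polynomial.coe_C, map_sub]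
      ring
    conv_lhs => rw [hN]
    have hphi : ∀ P : Polynomial ℚ, ((P.comp (Polynomial.X - Polynomial.C (k : ℚ)) : Polynomial ℚ) : PowerSeries ℚ)
      = (Polynomial.coeToPowerSeries.ringHom.comp (Polynomial.compRingHom (Polynomial.X - Polynomial.C (k : ℚ)))) P := by
      intro P; rfl
    have hl2 : ∀ l : ℕ, (Polynomial.coeToPowerSeries.ringHom.comp (Polynomial.compRingHom (Polynomial.X - Polynomial.C (k : ℚ)))) (Polynomial.X + Polynomial.C (l : ℚ)) = PowerSeries.X + PowerSeries.C ((l : ℚ) - k) := by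
      intro l
      rw [← hphi, ← hlin]; simp
    have hC : ∀ c : ℚ, (Polynomial.coeToPowerSeries.ringHom.comp (Polynomial.compRingHom (Polynomial.X - Polynomial.C (k : ℚ)))) (Polynomial.C c) = PowerSeries.C c := by
      intro l
      rw [← hphi]; simp
    rw [hphi]
    simp only [map_sum, map_mul, map_pow, map_prod, hl2, hC]
  have hdvd : PowerSeries.X ^ m ∣ (U - ∑ i ∈ Finset.Icc 1 m, PowerSeries.C (a i k) * PowerSeries.X ^ (m - i)) * Dk n k ^ m := by
    rw [sub_mul, hU, hcomp, Finset.sum_mul, ← Finset.sum_sub_distrib]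
    refine Finset.dvd_sum fun i hi => ?_
    have hkm : k ∈ Finset.range (n + 1) := Finset.mem_range.2 (by omega)
    rw [← Finset.add_sum_erase _ _ hkm, sub_self, map_zero, add_zero]
    unfold Dk
    rw [add_sub_cancel_left]
    refine Finset.dvd_sum fun l hl => ?_
    refine Dvd.dvd.mul_left ?_ _
    refine pow_dvd_pow_of_dvd ?_ _
    have : k ∈ (Finset.range (n + 1)).erase l :=
      Finset.mem_erase.2 ⟨(Finset.mem_erase.1 hl).1.symm, hkm⟩
    have h2 := Finset.dvd_prod_of_mem (fun l' : ℕ => (PowerSeries.X + PowerSeries.C ((l' : ℚ) - k) : PowerSeries ℚ)) this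
    simpa using h2
  have hunit : IsUnit (Dk n k ^ m) := by
    apply IsUnit.pow
    rw [PowerSeries.isUnit_iff_constantCoeff]
    exact isUnit_iff_ne_zero.2 (Dk_const n k)
  rw [hunit.dvd_mul_right, PowerSeries.X_pow_dvd_iff] at hdvd
  have h4 := hdvd (m - i) (by omega)
  rw [map_sub, sub_eq_zero] at h4
  rw [h4, map_sum, Finset.sum_eq_single i]
  · simp [PowerSeries.coeff_C_mul]
  · intro b hb hbi
    rw [PowerSeries.coeff_C_mul, PowerSeries.coeff_X_pow, if_neg, mul_zero]
    have := Finset.mem_Icc.1 hb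
    omega
  · intro h; exact absurd (Finset.mem_Icc.2 ⟨hi, him⟩) h

/-- the subring of integers in `ℚ` -/
def Zs : Subring ℚ := (Int.castRingHom ℚ).range

lemma int_mem_Zs (z : ℤ) : (z : ℚ) ∈ Zs := ⟨z, rfl⟩

/-- substitution `t ↦ X - k` -/
noncomputable def shiftHom (k : ℕ) : Polynomial ℚ →+* PowerSeries ℚ :=
  Polynomial.coeToPowerSeries.ringHom.comp
    (Polynomial.compRingHom (Polynomial.X - Polynomial.C (k : ℚ)))

lemma shiftHom_apply (k : ℕ) (P : Polynomial ℚ) : shiftHom k P =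
    ((P.comp (Polynomial.X - Polynomial.C (k : ℚ)) : Polynomial ℚ) : PowerSeries ℚ) := rfl

lemma shiftHom_C (k : ℕ) (c : ℚ) : shiftHom k (Polynomial.C c) = PowerSeries.C c := by
  rw [shiftHom_apply]; simp

lemma shiftHom_X (k : ℕ) :
    shiftHom k Polynomial.X = PowerSeries.X - PowerSeries.C (k : ℚ) := by
  rw [shiftHom_apply, Polynomial.X_comp, Polynomial.coe_sub, Polynomial.coe_X, Polynomial.coe_C]

lemma shiftHom_lin (k : ℕ) (c : ℚ) : shiftHom k (Polynomial.X + Polynomial.C c) =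
    PowerSeries.X + PowerSeries.C (c - k) := by
  rw [map_add, shiftHom_C, shiftHom_X, map_sub]; ring

lemma prod_erase_eq (n k : ℕ) (hk : k ≤ n) :
    ∏ l ∈ (Finset.range (n + 1)).erase k, ((l : ℚ) - k) =
      (-1) ^ k * (k.factorial * (n - k).factorial) := by
  obtain ⟨m, rfl⟩ := Nat.exists_eq_add_of_le hk
  rw [Nat.add_sub_cancel_left]
  clear hk
  induction m with
  | zero =>
    have : (Finset.range (k + 0 + 1)).erase k = Finset.range k := by
      ext x; simp; omega
    rw [this, ← Finset.prod_range_reflect]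
    have h2 : ∀ j ∈ Finset.range k, (((k - 1 - j : ℕ) : ℚ) - k) = (-1) * ((j + 1 : ℕ) : ℚ) := by
      intro j hj
      have := Finset.mem_range.1 hj
      have h3 : k = (k - 1 - j) + (j + 1) := by omega
      have h4 : (k : ℚ) = ((k - 1 - j : ℕ) : ℚ) + ((j + 1 : ℕ) : ℚ) := by exact_mod_cast h3
      linarith
    rw [Finset.prod_congr rfl h2, Finset.prod_mul_distrib, Finset.prod_const, Finset.card_range,
      ← Nat.cast_prod, Finset.prod_range_add_one_eq_factorial]
    simp
  | succ m ih =>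
    have : (Finset.range (k + (m + 1) + 1)).erase k =
        insert (k + (m + 1)) ((Finset.range (k + m + 1)).erase k) := by
      ext x; simp; omega
    rw [this, Finset.prod_insert (by simp), ih, Nat.factorial_succ]
    push_cast; ring

/-- numerator polynomial `2^{3n} (t+e/4)_n` -/
noncomputable def Npol (n : ℕ) (e : ℕ) : Polynomial ℚ :=
  Polynomial.C (2 ^ (3 * n)) * ∏ j ∈ Finset.range n, (Polynomial.X + Polynomial.C ((e : ℚ) / 4 + j))

lemma Npol_eval (n e : ℕ) (t : ℚ) : (Npol n e).eval t = 2 ^ (3 * n) * poch (t + e / 4) n := by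
  unfold Npol poch
  simp only [Polynomial.eval_mul, Polynomial.eval_C, Polynomial.eval_prod, Polynomial.eval_add,
    Polynomial.eval_X, add_assoc]

lemma Npol_eval_neg (n e l : ℕ) : (Npol n e).eval (-(l : ℚ)) =
    ((2 ^ n * ∏ j ∈ Finset.range n, (4 * (j : ℤ) + (e - 4 * l)) : ℤ) : ℚ) := by
  rw [Npol_eval, poch]
  push_cast
  have : (2 : ℚ) ^ (3 * n) = 2 ^ n * ∏ j ∈ Finset.range n, 4 := by
    rw [Finset.prod_const, Finset.card_range, pow_mul, ← mul_pow]; norm_num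
  rw [this, mul_assoc, ← Finset.prod_mul_distrib]
  congr 1
  refine Finset.prod_congr rfl fun j _ => ?_
  ring

lemma factorial_dvd_two_pow_mul (n : ℕ) (a : ℤ) :
    (n.factorial : ℤ) ∣ 2 ^ n * ∏ j ∈ Finset.range n, (4 * (j : ℤ) + a) := by
  have : Fact (Nat.Prime 2) := ⟨Nat.prime_two⟩
  obtain ⟨e, m, hm, hnm⟩ := Nat.exists_eq_two_pow_mul_odd (Nat.factorial_ne_zero n)
  have he : e ≤ n := by
    refine le_trans ?_ (padicValNat_factorial_le (p := 2) n)
    rw [← padicValNat_dvd_iff_le (Nat.factorial_ne_zero n), hnm]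
    exact dvd_mul_right _ _
  have hm2 : (m : ℤ) ∣ ∏ j ∈ Finset.range n, (4 * (j : ℤ) + a) := by
    have hcop : IsCoprime (4 : ℤ) (m : ℤ) := by
      have : Nat.Coprime 4 m := by
        have h2 : Nat.Coprime (2 ^ 2) m := Nat.Coprime.pow_left 2 (Nat.coprime_two_left.2 hm)
        simpa using h2
      exact_mod_cast Nat.isCoprime_iff_coprime.2 this
    obtain ⟨u, v, huv⟩ := hcop
    have h1 : (m : ℤ) ∣ ∏ j ∈ Finset.range n, (u * a + j) := by
      refine dvd_trans ?_ (Nat.factorial_coe_dvd_prod n (u * a))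
      rw [hnm]; push_cast; exact dvd_mul_left _ _
    have h3 : ∏ j ∈ Finset.range n, (4 * (j : ℤ) + a) ≡
        ∏ j ∈ Finset.range n, (4 * (u * a + (j : ℤ))) [ZMOD m] := by
      apply Int.ModEq.prod
      intro j _
      apply Int.ModEq.symm
      rw [Int.modEq_iff_dvd]
      exact ⟨v * a, by linear_combination (-a) * huv⟩
    rw [Finset.prod_mul_distrib] at h3
    exact h3.dvd_iff.2 (Dvd.dvd.mul_left h1 _)
  rw [hnm]
  push_cast
  exact mul_dvd_mul (pow_dvd_pow _ he) hm2

lemma ck_int (n k e : ℕ) (hk : k ≤ n) : (Npol n e).eval (-(k : ℚ)) *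
    (∏ l ∈ (Finset.range (n + 1)).erase k, ((l : ℚ) - k))⁻¹ ∈ Zs := by
  rw [prod_erase_eq n k hk, Npol_eval_neg]
  have h1 : ((k.factorial * (n - k).factorial : ℕ) : ℤ) ∣
      2 ^ n * ∏ j ∈ Finset.range n, (4 * (j : ℤ) + (e - 4 * k)) :=
    dvd_trans (by exact_mod_cast Nat.factorial_mul_factorial_dvd_factorial hk)
      (factorial_dvd_two_pow_mul n _)
  obtain ⟨z, hz⟩ := h1
  rw [hz]
  refine ⟨(-1) ^ k * z, ?_⟩
  have h2 : (k.factorial : ℚ) ≠ 0 := by exact_mod_cast Nat.factorial_ne_zero _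
  have h3 : ((n - k).factorial : ℚ) ≠ 0 := by exact_mod_cast Nat.factorial_ne_zero _
  simp only [eq_intCast]
  push_cast
  rcases neg_one_pow_eq_or ℚ k with h | h <;> rw [h] <;> field_simp

/-- the power series of `X * G(X-k)`. -/
noncomputable def Ue (n k e : ℕ) : PowerSeries ℚ := shiftHom k (Npol n e) * (Dk n k)⁻¹

lemma Ue_mul (n k e : ℕ) : Ue n k e * Dk n k = shiftHom k (Npol n e) := by
  rw [Ue, mul_assoc, PowerSeries.inv_mul_cancel _ (Dk_const n k), mul_one]

lemma dvd_dlcm {n l : ℕ} (h1 : 1 ≤ l) (h2 : l ≤ n) : l ∣ dlcm n :=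
  Finset.dvd_lcm (f := id) (Finset.mem_Icc.2 ⟨h1, h2⟩)

lemma dlcm_div_mem {n l k : ℕ} (hl : l ≤ n) (hk : k ≤ n) (hlk : l ≠ k) :
    (dlcm n : ℚ) * ((l : ℚ) - k)⁻¹ ∈ Zs := by
  have h : ((l : ℤ) - k) ∣ (dlcm n : ℤ) := by
    rw [← Int.natAbs_dvd, Int.natCast_dvd_natCast]
    apply dvd_dlcm <;> omega
  obtain ⟨z, hz⟩ := h
  have hne : (l : ℚ) - k ≠ 0 := by
    rw [sub_ne_zero]; exact_mod_cast hlk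
  refine ⟨z, ?_⟩
  have : (dlcm n : ℚ) = ((l : ℚ) - k) * z := by exact_mod_cast hz
  rw [this]
  simp only [eq_intCast]
  field_simp

lemma lin_factor (c : ℚ) (hc : c ≠ 0) : (PowerSeries.X + PowerSeries.C c : PowerSeries ℚ) =
    PowerSeries.C c * (1 + PowerSeries.C c⁻¹ * PowerSeries.X) := by
  rw [mul_add, ← mul_assoc, ← map_mul, mul_inv_cancel₀ hc]
  simp [add_comm]

lemma Ue_mem (n k e : ℕ) (hk : k ≤ n) : Ue n k e ∈ scaledSubring Zs (dlcm n) := by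
  have hinj : Set.InjOn (fun l : ℕ => -(l : ℚ)) (Finset.range (n + 1)) := by
    intro a _ b _ h
    simpa using h
  have hdeg : (Npol n e).degree < (Finset.range (n + 1)).card := by
    rw [Finset.card_range]
    unfold Npol
    rw [Polynomial.degree_C_mul (by positivity), Polynomial.degree_prod]
    simp only [Polynomial.degree_X_add_C]
    simp
    exact_mod_cast Nat.lt_succ_self n
  have hL := Lagrange.eq_interpolate hinj hdeg
  rw [Lagrange.interpolate_apply] at hL
  have hkm : k ∈ Finset.range (n + 1) := Finset.mem_range.2 (by omega)
  have hexp : shiftHom k (Npol n e) = ∑ l ∈ Finset.range (n + 1),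
      PowerSeries.C ((Npol n e).eval (-(l : ℚ)) *
        (∏ l' ∈ (Finset.range (n + 1)).erase l, ((l' : ℚ) - l))⁻¹) *
      ∏ l' ∈ (Finset.range (n + 1)).erase l, (PowerSeries.X + PowerSeries.C ((l' : ℚ) - k)) := by
    conv_lhs => rw [hL]
    rw [map_sum]
    refine Finset.sum_congr rfl fun l _ => ?_
    rw [map_mul, shiftHom_C, Lagrange.basis, map_prod, map_mul, mul_assoc]
    congr 1
    rw [← Finset.prod_inv_distrib, map_prod, ← Finset.prod_mul_distrib]
    refine Finset.prod_congr rfl fun l' _ => ?_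
    rw [Lagrange.basisDivisor, map_mul, shiftHom_C, map_neg, sub_neg_eq_add, sub_neg_eq_add, shiftHom_lin]
    congr 3
    ring
  rw [Ue, hexp, Finset.sum_mul]
  refine sum_mem fun l hl => ?_
  rw [mul_assoc]
  refine mul_mem (scaled_C (ck_int n l e (by have := Finset.mem_range.1 hl; omega))) ?_
  by_cases hlk : l = k
  · subst hlk
    have := PowerSeries.mul_inv_cancel _ (Dk_const n l)
    unfold Dk at this ⊢
    rw [this]
    exact one_mem _
  · have hne : (l : ℚ) - k ≠ 0 := by rw [sub_ne_zero]; exact_mod_cast hlk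
    have hln : l ≤ n := by have := Finset.mem_range.1 hl; omega
    have e1 : (PowerSeries.X + PowerSeries.C ((l : ℚ) - k)) *
        ∏ l' ∈ (Finset.range (n + 1)).erase l, (PowerSeries.X + PowerSeries.C ((l' : ℚ) - k)) =
        PowerSeries.X * Dk n k := by
      rw [Finset.mul_prod_erase _ (fun l' : ℕ =>
        (PowerSeries.X + PowerSeries.C ((l' : ℚ) - k) : PowerSeries ℚ)) hl,
        ← Finset.mul_prod_erase _ _ hkm, Dk]
      simp
    have hc0 : PowerSeries.constantCoeff (1 + PowerSeries.C ((l : ℚ) - k)⁻¹ * PowerSeries.X) ≠ 0 := by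
      simp
    have e2 : (∏ l' ∈ (Finset.range (n + 1)).erase l,
        (PowerSeries.X + PowerSeries.C ((l' : ℚ) - k))) * (Dk n k)⁻¹ =
        (PowerSeries.C ((l : ℚ) - k)⁻¹ * PowerSeries.X) *
          (1 + PowerSeries.C ((l : ℚ) - k)⁻¹ * PowerSeries.X)⁻¹ := by
      rw [PowerSeries.eq_mul_inv_iff_mul_eq hc0]
      have hCC : PowerSeries.C ((l : ℚ) - k)⁻¹ * PowerSeries.C ((l : ℚ) - k) = 1 := by
        rw [← map_mul, inv_mul_cancel₀ hne, map_one]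
      have hDD := PowerSeries.mul_inv_cancel _ (Dk_const n k)
      rw [lin_factor _ hne] at e1
      linear_combination (PowerSeries.C ((l : ℚ) - k)⁻¹ * (Dk n k)⁻¹) * e1 + 
        (PowerSeries.C ((l : ℚ) - k)⁻¹ * PowerSeries.X) * hDD - ((∏ l' ∈ (Finset.range (n + 1)).erase l,
        (PowerSeries.X + PowerSeries.C ((l' : ℚ) - k))) * (Dk n k)⁻¹ * 
          (1 + PowerSeries.C ((l : ℚ) - k)⁻¹ * PowerSeries.X)) * hCC
    rw [e2]
    have h5 := dlcm_div_mem hln hk hlk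
    exact mul_mem (scaled_CX h5) (scaled_inv h5)

/-- the localization of `ℤ` at `q` inside `ℚ` -/
def Rq (q : ℕ) (hq : q.Prime) : Subring ℚ where
  carrier := {x | ∃ m : ℤ, ¬ (q : ℤ) ∣ m ∧ ∃ z : ℤ, (m : ℚ) * x = z}
  mul_mem' := by
    rintro a b ⟨m, hm, z, hz⟩ ⟨m', hm', z', hz'⟩
    refine ⟨m * m', ?_, z * z', ?_⟩
    · intro h
      rcases (Nat.prime_iff_prime_int.1 hq).dvd_or_dvd h with h | h
      · exact hm h
      · exact hm' h
    · push_cast; rw [← hz, ← hz']; ring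
  one_mem' := ⟨1, fun h => (Nat.prime_iff_prime_int.1 hq).not_dvd_one h, 1, by simp⟩
  add_mem' := by
    rintro a b ⟨m, hm, z, hz⟩ ⟨m', hm', z', hz'⟩
    refine ⟨m * m', ?_, z * m' + z' * m, ?_⟩
    · intro h
      rcases (Nat.prime_iff_prime_int.1 hq).dvd_or_dvd h with h | h
      · exact hm h
      · exact hm' h
    · push_cast; rw [← hz, ← hz']; ring
  zero_mem' := ⟨1, fun h => (Nat.prime_iff_prime_int.1 hq).not_dvd_one h, 0, by simp⟩
  neg_mem' := by
    rintro a ⟨m, hm, z, hz⟩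
    exact ⟨m, hm, -z, by push_cast; rw [← hz]; ring⟩

lemma q_div_mem (q : ℕ) (hq : q.Prime) (b : ℤ) (hb : b ≠ 0) (hb2 : |b| < (q : ℤ) ^ 2) :
    (q : ℚ) * (b : ℚ)⁻¹ ∈ Rq q hq := by
  have hb' : (b : ℚ) ≠ 0 := by exact_mod_cast hb
  by_cases h : (q : ℤ) ∣ b
  · obtain ⟨c, rfl⟩ := h
    have hc : c ≠ 0 := by rintro rfl; simp at hb
    refine ⟨c, ?_, 1, ?_⟩
    · rintro ⟨w, rfl⟩
      have : (q : ℤ) ^ 2 ∣ (q : ℤ) * (q * w) := ⟨w, by ring⟩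
      exact hb (Int.eq_zero_of_abs_lt_dvd this hb2)
    · have hc' : (c : ℚ) ≠ 0 := by exact_mod_cast hc
      have hq' : (q : ℚ) ≠ 0 := by exact_mod_cast hq.ne_zero
      push_cast
      field_simp
  · refine ⟨b, h, q, ?_⟩
    push_cast
    field_simp

lemma Ue_qloc (n k e q : ℕ) (hk : k ≤ n) (he : e = 1 ∨ e = 3) (hq : q.Prime)
    (hqn : 10 * n < q ^ 2) :
    ∃ F ∈ scaledSubring (Rq q hq) q, Ue n k e = PowerSeries.C ((Npol n e).eval (-(k : ℚ)) *
      (∏ l ∈ (Finset.range (n + 1)).erase k, ((l : ℚ) - k))⁻¹) * F := by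
  have hqn' : 10 * (n : ℤ) < (q : ℤ) ^ 2 := by exact_mod_cast hqn
  have hbne : ∀ j : ℕ, (4 * (j : ℤ) + e - 4 * k) ≠ 0 := by intro j; omega
  have hβ : ∀ j : ℕ, (e : ℚ) / 4 + j - k = ((4 * (j : ℤ) + e - 4 * k : ℤ) : ℚ) / 4 := by
    intro j; push_cast; ring
  have hβ0 : ∀ j : ℕ, (e : ℚ) / 4 + j - k ≠ 0 := by
    intro j
    rw [hβ]
    have : ((4 * (j : ℤ) + e - 4 * k : ℤ) : ℚ) ≠ 0 := by exact_mod_cast hbne j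
    exact div_ne_zero this (by norm_num)
  have hnum : shiftHom k (Npol n e) = PowerSeries.C ((Npol n e).eval (-(k : ℚ))) *
      ∏ j ∈ Finset.range n, (1 + PowerSeries.C ((e : ℚ) / 4 + j - k)⁻¹ * PowerSeries.X) := by
    have h1 : (Npol n e).eval (-(k : ℚ)) =
        2 ^ (3 * n) * ∏ j ∈ Finset.range n, ((e : ℚ) / 4 + j - k) := by
      rw [Npol_eval, poch]
      congr 1
      refine Finset.prod_congr rfl fun j _ => ?_
      ring
    rw [h1, Npol, map_mul, shiftHom_C, map_prod, map_mul, map_prod, mul_assoc,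
      ← Finset.prod_mul_distrib]
    congr 1
    refine Finset.prod_congr rfl fun j _ => ?_
    rw [shiftHom_lin, lin_factor _ (hβ0 j)]
  have hne : ∀ l ∈ (Finset.range (n + 1)).erase k, (l : ℚ) - k ≠ 0 := by
    intro l hl
    rw [sub_ne_zero]; exact_mod_cast (Finset.mem_erase.1 hl).1
  have hden : (Dk n k)⁻¹ =
      PowerSeries.C (∏ l ∈ (Finset.range (n + 1)).erase k, ((l : ℚ) - k))⁻¹ *
      ∏ l ∈ (Finset.range (n + 1)).erase k,
        (1 + PowerSeries.C ((l : ℚ) - k)⁻¹ * PowerSeries.X)⁻¹ := by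
    symm
    rw [PowerSeries.eq_inv_iff_mul_eq_one (Dk_const n k), Dk, ← Finset.prod_inv_distrib, map_prod,
      ← Finset.prod_mul_distrib, ← Finset.prod_mul_distrib]
    refine Finset.prod_eq_one fun l hl => ?_
    have hCC : PowerSeries.C ((l : ℚ) - k)⁻¹ * PowerSeries.C ((l : ℚ) - k) = 1 := by
      rw [← map_mul, inv_mul_cancel₀ (hne l hl), map_one]
    have hDD := PowerSeries.inv_mul_cancel
      (1 + PowerSeries.C ((l : ℚ) - k)⁻¹ * PowerSeries.X) (by simp)
    rw [lin_factor _ (hne l hl)]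
    calc _ = (PowerSeries.C ((l : ℚ) - k)⁻¹ * PowerSeries.C ((l : ℚ) - k)) *
          ((1 + PowerSeries.C ((l : ℚ) - k)⁻¹ * PowerSeries.X)⁻¹ *
          (1 + PowerSeries.C ((l : ℚ) - k)⁻¹ * PowerSeries.X)) := by ring
      _ = 1 := by rw [hCC, hDD, one_mul]
  refine ⟨(∏ j ∈ Finset.range n, (1 + PowerSeries.C ((e : ℚ) / 4 + j - k)⁻¹ * PowerSeries.X)) *
    ∏ l ∈ (Finset.range (n + 1)).erase k,
        (1 + PowerSeries.C ((l : ℚ) - k)⁻¹ * PowerSeries.X)⁻¹, mul_mem ?_ ?_, ?_⟩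
  · refine prod_mem fun j hj => add_mem (one_mem _) (scaled_CX ?_)
    have hj := Finset.mem_range.1 hj
    rw [hβ, inv_div, div_eq_mul_inv, mul_left_comm]
    refine mul_mem ⟨1, fun h => (Nat.prime_iff_prime_int.1 hq).not_dvd_one h, 4, by norm_num⟩
      (q_div_mem q hq _ (hbne j) ?_)
    rw [abs_lt]
    constructor <;> omega
  · refine prod_mem fun l hl => scaled_inv ?_
    have h1 := Finset.mem_erase.1 hl
    have h2 := Finset.mem_range.1 h1.2
    have := q_div_mem q hq ((l : ℤ) - k) (by omega) (by rw [abs_lt]; constructor <;> omega)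
    push_cast at this
    exact this
  · rw [Ue, hnum, hden, map_mul]; ring

/-- `∏_{i<m} (4i+1)(4i+3)`. -/
def Qm (m : ℕ) : ℚ := ∏ i ∈ Finset.range m, ((4 * (i : ℚ) + 1) * (4 * i + 3))

lemma Qm_fact (m : ℕ) : Qm m * (2 * m).factorial * 4 ^ m = (4 * m).factorial := by
  induction m with
  | zero => simp [Qm]
  | succ m ih =>
    have h1 : Qm (m + 1) = Qm m * ((4 * (m : ℚ) + 1) * (4 * m + 3)) := by
      unfold Qm; rw [Finset.prod_range_succ]
    have h2 : ((2 * (m + 1)).factorial : ℚ) = (2 * m + 2) * ((2 * m + 1) * (2 * m).factorial) := by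
      rw [show 2 * (m + 1) = 2 * m + 1 + 1 by ring, Nat.factorial_succ, Nat.factorial_succ]
      push_cast; ring
    have h3 : ((4 * (m + 1)).factorial : ℚ) =
        (4 * m + 4) * ((4 * m + 3) * ((4 * m + 2) * ((4 * m + 1) * (4 * m).factorial))) := by
      rw [show 4 * (m + 1) = 4 * m + 1 + 1 + 1 + 1 by ring, Nat.factorial_succ, Nat.factorial_succ,
        Nat.factorial_succ, Nat.factorial_succ]
      push_cast; ring
    rw [h1, h2, h3, ← ih]
    ring

/-- `(4m)!/((2m)! m!^2)` -/
def Mm (m : ℕ) : ℕ := (4 * m).choose (2 * m) * (2 * m).choose m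

lemma Qm_eq (m : ℕ) : 4 ^ m * Qm m = Mm m * (m.factorial : ℚ) ^ 2 := by
  have h1 := Nat.choose_mul_factorial_mul_factorial (show 2 * m ≤ 4 * m by omega)
  have h2 := Nat.choose_mul_factorial_mul_factorial (show m ≤ 2 * m by omega)
  rw [show 4 * m - 2 * m = 2 * m by omega] at h1
  rw [show 2 * m - m = m by omega] at h2
  have h3 := Qm_fact m
  have h4 : ((2 * m).factorial : ℚ) ≠ 0 := by exact_mod_cast Nat.factorial_ne_zero _
  apply mul_left_cancel₀ h4
  have h1' : ((4 * m).choose (2 * m) : ℚ) * (2 * m).factorial * (2 * m).factorial =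
    (4 * m).factorial := by exact_mod_cast h1
  have h2' : ((2 * m).choose m : ℚ) * m.factorial * m.factorial =
    (2 * m).factorial := by exact_mod_cast h2
  unfold Mm
  push_cast
  rw [← h1'] at h3
  linear_combination h3 - ((4 * m).choose (2 * m) : ℚ) * (2 * m).factorial * h2'

lemma c_eq (n k : ℕ) (hk : k ≤ n) :
    ((Npol n 1).eval (-(k : ℚ)) * (∏ l ∈ (Finset.range (n + 1)).erase k, ((l : ℚ) - k))⁻¹) *
    ((Npol n 3).eval (-(k : ℚ)) * (∏ l ∈ (Finset.range (n + 1)).erase k, ((l : ℚ) - k))⁻¹) =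
    ((Mm k * Mm (n - k) : ℕ) : ℚ) := by
  rw [prod_erase_eq n k hk, Npol_eval_neg, Npol_eval_neg]
  have hprod : (∏ j ∈ Finset.range n, (4 * (j : ℚ) + (1 - 4 * k))) *
      (∏ j ∈ Finset.range n, (4 * (j : ℚ) + (3 - 4 * k))) = Qm k * Qm (n - k) := by
    rw [← Finset.prod_mul_distrib]
    obtain ⟨m, rfl⟩ := Nat.exists_eq_add_of_le hk
    rw [Nat.add_sub_cancel_left, Finset.prod_range_add, ← Finset.prod_range_reflect]
    unfold Qm
    congr 1
    · refine Finset.prod_congr rfl fun j hj => ?_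
      have := Finset.mem_range.1 hj
      have h3 : k = (k - 1 - j) + (j + 1) := by omega
      have h4 : (k : ℚ) = ((k - 1 - j : ℕ) : ℚ) + ((j + 1 : ℕ) : ℚ) := by exact_mod_cast h3
      push_cast at h4
      have h5 : ((k - 1 - j : ℕ) : ℚ) = k - 1 - j := by linarith
      rw [h5]; ring
    · refine Finset.prod_congr rfl fun j hj => ?_
      push_cast; ring
  have e1 := Qm_eq k
  have e2 := Qm_eq (n - k)
  have h4 : (2 : ℚ) ^ n * 2 ^ n = 4 ^ k * 4 ^ (n - k) := by
    rw [← mul_pow, ← pow_add, Nat.add_sub_cancel' hk]; norm_num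
  have h2 : (k.factorial : ℚ) ≠ 0 := by exact_mod_cast Nat.factorial_ne_zero _
  have h3 : ((n - k).factorial : ℚ) ≠ 0 := by exact_mod_cast Nat.factorial_ne_zero _
  have hs : ((-1 : ℚ) ^ k) * (-1) ^ k = 1 := by rw [← mul_pow]; norm_num
  have hs0 : ((-1 : ℚ) ^ k) ≠ 0 := by positivity
  rw [← div_eq_mul_inv, ← div_eq_mul_inv, div_mul_div_comm, div_eq_iff (by positivity)]
  push_cast
  calc _ = (2 ^ n * 2 ^ n) * ((∏ j ∈ Finset.range n, (4 * (j : ℚ) + (1 - 4 * k))) *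
      (∏ j ∈ Finset.range n, (4 * (j : ℚ) + (3 - 4 * k)))) := by ring
    _ = (4 ^ k * Qm k) * (4 ^ (n - k) * Qm (n - k)) := by rw [hprod, h4]; ring
    _ = (((-1 : ℚ) ^ k) * (-1) ^ k) * ((Mm k * (k.factorial : ℚ) ^ 2) *
      (Mm (n - k) * ((n - k).factorial : ℚ) ^ 2)) := by rw [e1, e2, hs, one_mul]
    _ = _ := by ring

lemma q_dvd_choose (q a b : ℕ) (hq : q.Prime) (h : a % q < b % q) : q ∣ a.choose b := by
  have : Fact q.Prime := ⟨hq⟩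
  have h1 := Choose.choose_modEq_choose_mod_mul_choose_div_nat (n := a) (k := b) (p := q)
  rw [Nat.choose_eq_zero_of_lt h, zero_mul] at h1
  exact (Nat.modEq_zero_iff_dvd).1 h1

lemma mod_two_mul (q m : ℕ) (hq : 0 < q) (h : q ≤ 2 * (m % q)) : (2 * m) % q < m % q := by
  have h1 := Nat.mod_lt m hq
  have h2 : 2 * m = (2 * (m % q) - q) + q * (2 * (m / q) + 1) := by
    have := Nat.mod_add_div m q
    have h3 : q * (2 * (m / q) + 1) = 2 * (q * (m / q)) + q := by ring
    omega
  rw [h2, Nat.add_mul_mod_self_left, Nat.mod_eq_of_lt] <;> omega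

lemma q_dvd_Mm (q m : ℕ) (hq : q.Prime) (h : q ≤ 4 * (m % q)) : q ∣ Mm m := by
  unfold Mm
  by_cases h2 : q ≤ 2 * (m % q)
  · exact Dvd.dvd.mul_left (q_dvd_choose q _ _ hq (mod_two_mul q m hq.pos h2)) _
  · refine Dvd.dvd.mul_right (q_dvd_choose q _ _ hq ?_) _
    rw [show 4 * m = 2 * (2 * m) by ring]
    apply mod_two_mul q _ hq.pos
    have : (2 * m) % q = 2 * (m % q) := by
      rw [← Nat.mul_mod_mod, Nat.mod_eq_of_lt (by omega)]
    omega

lemma q_dvd_MM (q n k : ℕ) (hq : q.Prime) (hk : k ≤ n) (h : q < 2 * (n % q)) :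
    q ∣ Mm k * Mm (n - k) := by
  by_cases h1 : q ≤ 4 * (k % q)
  · exact Dvd.dvd.mul_right (q_dvd_Mm q k hq h1) _
  · refine Dvd.dvd.mul_left (q_dvd_Mm q _ hq ?_) _
    by_contra h2
    have h3 : n % q = k % q + (n - k) % q := by
      conv_lhs => rw [← Nat.add_sub_cancel' hk]
      rw [Nat.add_mod, Nat.mod_eq_of_lt (by omega)]
    omega

lemma H_coeff_q (n k q : ℕ) (hk : k ≤ n) (hq : q.Prime) (hqn : 10 * n < q ^ 2) (hqle : q ≤ n)
    (h : q < 2 * (n % q)) (j : ℕ) (z : ℤ)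
    (hz : (dlcm n : ℚ) ^ j * PowerSeries.coeff j (Ue n k 1 * Ue n k 3) = z) : (q : ℤ) ∣ z := by
  obtain ⟨F, hF, hF'⟩ := Ue_qloc n k 1 q hk (Or.inl rfl) hq hqn
  obtain ⟨G, hG, hG'⟩ := Ue_qloc n k 3 q hk (Or.inr rfl) hq hqn
  have hH : Ue n k 1 * Ue n k 3 = PowerSeries.C ((Mm k * Mm (n - k) : ℕ) : ℚ) * (F * G) := by
    rw [← c_eq n k hk, map_mul, hF', hG']; ring
  obtain ⟨c, hc⟩ := q_dvd_MM q n k hq hk h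
  obtain ⟨D, hD⟩ := dvd_dlcm hq.one_le hqle
  obtain ⟨m, hm, w, hw⟩ := mem_scaled.1 (mul_mem hF hG) j
  rw [hH, PowerSeries.coeff_C_mul, hc, hD] at hz
  have : (q : ℤ) ∣ m * z := by
    refine ⟨c * D ^ j * w, ?_⟩
    have h2 : (m : ℚ) * z = q * (c * D ^ j * w) := by
      rw [← hz, ← hw]; push_cast; ring
    exact_mod_cast h2
  exact ((Nat.prime_iff_prime_int.1 hq).dvd_or_dvd this).resolve_left hm

lemma Phi_dvd (n : ℕ) (z : ℤ) (h : ∀ q : ℕ, q.Prime → 10 * n < q ^ 2 → q ≤ n → q < 2 * (n % q) →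
    (q : ℤ) ∣ z) : (Phi n : ℤ) ∣ z := by
  classical
  rw [Int.natCast_dvd]
  unfold Phi
  rw [← Finset.prod_filter]
  apply Finset.prod_primes_dvd
  · intro q hq
    exact (Finset.mem_filter.1 hq).2.1.prime
  · intro q hq
    obtain ⟨h1, h2, h3, h4⟩ := Finset.mem_filter.1 hq
    rw [← Int.natCast_dvd]
    have hq0 : (0 : ℝ) < q := by exact_mod_cast h2.pos
    refine h q h2 ?_ (Finset.mem_Icc.1 h1).2 ?_
    · rw [Real.sqrt_lt' hq0] at h3
      exact_mod_cast h3
    · rw [Int.fract_div_natCast_eq_div_natCast_mod, div_lt_div_iff₀ (by norm_num) hq0] at h4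
      have : (q : ℝ) < 2 * (n % q : ℕ) := by linarith
      exact_mod_cast this

lemma H_mem (n k : ℕ) (hk : k ≤ n) : ∃ H ∈ scaledSubring Zs (dlcm n),
    Ue n k 1 * Ue n k 3 = PowerSeries.C (Phi n : ℚ) * H := by
  have h1 := mem_scaled.1 (mul_mem (Ue_mem n k 1 hk) (Ue_mem n k 3 hk))
  have hd : (dlcm n : ℚ) ≠ 0 := by
    have : dlcm n ≠ 0 := by
      unfold dlcm
      rw [Ne, Finset.lcm_eq_zero_iff]
      simp
    exact_mod_cast this
  have h2 : ∀ j, ∃ z : ℤ, (dlcm n : ℚ) ^ j * PowerSeries.coeff j (Ue n k 1 * Ue n k 3) =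
      Phi n * z := by
    intro j
    obtain ⟨z, hz⟩ := h1 j
    obtain ⟨w, rfl⟩ := Phi_dvd n z fun q a b c d => H_coeff_q n k q hk a b c d j z hz.symm
    refine ⟨w, ?_⟩
    rw [← hz]; simp
  choose z hz using h2
  refine ⟨PowerSeries.mk fun j => (z j : ℚ) / (dlcm n : ℚ) ^ j, ?_, ?_⟩
  · rw [mem_scaled]
    intro j
    rw [PowerSeries.coeff_mk, mul_div_cancel₀ _ (pow_ne_zero _ hd)]
    exact int_mem_Zs _
  · ext j
    rw [PowerSeries.coeff_C_mul, PowerSeries.coeff_mk, ← mul_div_assoc, ← hz j]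
    field_simp

lemma poch_nat (i m : ℕ) : ∃ z : ℤ, poch (i : ℚ) m = z :=
  ⟨∏ j ∈ Finset.range m, ((i : ℤ) + j), by unfold poch; push_cast; rfl⟩

lemma finish (n d P p s i : ℕ) (a : ℕ → ℚ)
    (h : ∀ k ≤ n, ∃ z : ℤ, (d : ℚ) ^ p * a k = P * z) :
    ∃ z : ℤ, (d : ℚ) ^ p * ((-1 : ℚ) ^ s * poch (i : ℚ) (s + 1) * 4 ^ (i + s) *
      ∑ k ∈ Finset.range (n + 1), a k) = P * (z : ℚ) := by
  obtain ⟨w, hw⟩ := poch_nat i (s + 1)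
  have h' : ∀ k : ℕ, ∃ z : ℤ, k ≤ n → (d : ℚ) ^ p * a k = P * z := by
    intro k
    by_cases hk : k ≤ n
    · obtain ⟨z, hz⟩ := h k hk
      exact ⟨z, fun _ => hz⟩
    · exact ⟨0, fun h => absurd h hk⟩
  choose z hz using h'
  refine ⟨(-1) ^ s * w * 4 ^ (i + s) * ∑ k ∈ Finset.range (n + 1), z k, ?_⟩
  have h3 : (d : ℚ) ^ p * ∑ k ∈ Finset.range (n + 1), a k =
      P * ∑ k ∈ Finset.range (n + 1), (z k : ℚ) := by
    rw [Finset.mul_sum, Finset.mul_sum]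
    refine Finset.sum_congr rfl fun k hk => hz k ?_
    have := Finset.mem_range.1 hk
    omega
  rw [hw]
  push_cast
  linear_combination ((-1 : ℚ) ^ s * w * 4 ^ (i + s)) * h3

lemma A_part (s δ n : ℕ) (a : ℕ → ℕ → ℚ)
    (ha : ∀ t : ℚ, (∀ k : ℕ, k ≤ n → t + (k : ℚ) ≠ 0) →
          Afun s δ n t = ∑ i ∈ Finset.Icc 1 (2 * s + 4), ∑ k ∈ Finset.range (n + 1),
            a i k / (t + (k : ℚ)) ^ i)
    (i : ℕ) (hi : 1 ≤ i) (hi2 : i ≤ 2 * s + 4) (k : ℕ) (hk : k ≤ n) :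
    ∃ z : ℤ, (dlcm n : ℚ) ^ (2 * s + 4 - i) * a i k = ((Phi n ^ (s + 2) : ℕ) : ℚ) * z := by
  set N : Polynomial ℚ := (Polynomial.C 4 * Polynomial.X + Polynomial.C (2 * (n : ℚ))) ^ δ *
    Npol n 1 ^ (s + 2) * Npol n 3 ^ (s + 2) with hN
  obtain ⟨H, hH, hHe⟩ := H_mem n k hk
  have hlin : shiftHom k (Polynomial.C 4 * Polynomial.X + Polynomial.C (2 * (n : ℚ))) =
      PowerSeries.C 4 * PowerSeries.X + PowerSeries.C (((2 * n - 4 * k : ℤ) : ℚ)) := by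
    rw [map_add, map_mul, shiftHom_C, shiftHom_C, shiftHom_X]
    push_cast
    rw [map_sub, map_mul PowerSeries.C 4]
    ring
  have hc := coeff_extract n (2 * s + 4) N a (fun t ht => by
      rw [← ha t ht, Afun, hN]
      simp only [Polynomial.eval_mul, Polynomial.eval_pow, Polynomial.eval_add, Polynomial.eval_C,
        Polynomial.eval_X, Npol_eval]
      push_cast
      congr 1
      have : (2 : ℚ) ^ ((6 * s + 12) * n) = (2 ^ (3 * n)) ^ (s + 2) * (2 ^ (3 * n)) ^ (s + 2) := by
        rw [← pow_mul, ← pow_add]; congr 1; ring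
      rw [this, mul_pow, mul_pow]
      ring) k hk
    ((PowerSeries.C 4 * PowerSeries.X + PowerSeries.C (((2 * n - 4 * k : ℤ) : ℚ))) ^ δ *
      (Ue n k 1 * Ue n k 3) ^ (s + 2)) (by
      rw [← shiftHom_apply, hN, map_mul, map_mul, map_pow, map_pow, map_pow, hlin, ← Ue_mul, ← Ue_mul,
        mul_pow, mul_pow, mul_pow]
      have : Dk n k ^ (2 * s + 4) = Dk n k ^ (s + 2) * Dk n k ^ (s + 2) := by
        rw [← pow_add]; congr 1; ring
      rw [this]; ring) i hi hi2
  rw [hHe, mul_pow, mul_left_comm, ← map_pow, PowerSeries.coeff_C_mul] at hc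
  have hm : (PowerSeries.C 4 * PowerSeries.X + PowerSeries.C (((2 * n - 4 * k : ℤ) : ℚ))) ^ δ *
      H ^ (s + 2) ∈ scaledSubring Zs (dlcm n) := by
    refine mul_mem (pow_mem (add_mem (scaled_CX ?_) (scaled_C (int_mem_Zs _))) _) (pow_mem hH _)
    exact ⟨dlcm n * 4, by simp⟩
  obtain ⟨z, hz⟩ := mem_scaled.1 hm (2 * s + 4 - i)
  refine ⟨z, ?_⟩
  rw [← hc, mul_left_comm, ← hz]
  push_cast
  simp

lemma B_part (s n : ℕ) (b : ℕ → ℕ → ℚ)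
    (hb : ∀ t : ℚ, (∀ k : ℕ, k ≤ n → t + (k : ℚ) ≠ 0) →
          Bfun s n t = ∑ i ∈ Finset.Icc 1 (s + 2), ∑ k ∈ Finset.range (n + 1),
            b i k / (t + (k : ℚ)) ^ i)
    (i : ℕ) (hi : 1 ≤ i) (hi2 : i ≤ s + 2) (k : ℕ) (hk : k ≤ n) :
    ∃ z : ℤ, (dlcm n : ℚ) ^ (s + 2 - i) * b i k = ((1 : ℕ) : ℚ) * z := by
  have hc := coeff_extract n (s + 2) (Npol n 3 ^ (s + 2)) b (fun t ht => by
      rw [← hb t ht, Bfun]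
      simp only [Polynomial.eval_pow, Npol_eval]
      push_cast
      congr 1
      have : (2 : ℚ) ^ ((3 * s + 6) * n) = (2 ^ (3 * n)) ^ (s + 2) := by
        rw [← pow_mul]; congr 1; ring
      rw [this, mul_pow]) k hk (Ue n k 3 ^ (s + 2)) (by
      rw [← shiftHom_apply, map_pow, ← Ue_mul, mul_pow]) i hi hi2
  obtain ⟨z, hz⟩ := mem_scaled.1 (pow_mem (Ue_mem n k 3 hk) (s + 2)) (s + 2 - i)
  refine ⟨z, ?_⟩
  rw [← hc, ← hz]
  simp

/-- Integrality of the linear-form coefficients `ρ_{n,i}` (for odd `n > (2s+4)²`) and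
`σ_{n,i}` (for every positive `n`): `Φ_n^{-(s+2)} d_n^{2s+4-i} ρ_{n,i} ∈ ℤ` and
`d_n^{s+2-i} σ_{n,i} ∈ ℤ`. -/
theorem linear_form_coefficients_integrality (s δ : ℕ) (hδ : δ ≤ 1) :
    (∀ n : ℕ, Odd n → (2 * s + 4) ^ 2 < n →
      ∀ a : ℕ → ℕ → ℚ,
        (∀ t : ℚ, (∀ k : ℕ, k ≤ n → t + (k : ℚ) ≠ 0) →
          Afun s δ n t = ∑ i ∈ Finset.Icc 1 (2 * s + 4), ∑ k ∈ Finset.range (n + 1),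
            a i k / (t + (k : ℚ)) ^ i) →
        ∀ i : ℕ, 1 ≤ i → i ≤ 2 * s + 4 →
          ∃ z : ℤ, (dlcm n : ℚ) ^ (2 * s + 4 - i) *
              ((-1 : ℚ) ^ s * poch (i : ℚ) (s + 1) * 4 ^ (i + s) *
                ∑ k ∈ Finset.range (n + 1), a i k) =
            (Phi n : ℚ) ^ (s + 2) * (z : ℚ)) ∧
    (∀ n : ℕ, 0 < n →
      ∀ b : ℕ → ℕ → ℚ,
        (∀ t : ℚ, (∀ k : ℕ, k ≤ n → t + (k : ℚ) ≠ 0) →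
          Bfun s n t = ∑ i ∈ Finset.Icc 1 (s + 2), ∑ k ∈ Finset.range (n + 1),
            b i k / (t + (k : ℚ)) ^ i) →
        ∀ i : ℕ, 1 ≤ i → i ≤ s + 2 →
          ∃ z : ℤ, (dlcm n : ℚ) ^ (s + 2 - i) *
              ((-1 : ℚ) ^ s * poch (i : ℚ) (s + 1) * 4 ^ (i + s) *
                ∑ k ∈ Finset.range (n + 1), b i k) = (z : ℚ)) := by

  refine ⟨?_, ?_⟩
  · intro n _ _ a ha i hi hi2
    obtain ⟨z, hz⟩ := finish n (dlcm n) (Phi n ^ (s + 2)) (2 * s + 4 - i) s i (a i)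
      (fun k hk => A_part s δ n a ha i hi hi2 k hk)
    refine ⟨z, ?_⟩
    rw [hz]
    push_cast
    rfl
  · intro n _ b hb i hi hi2
    obtain ⟨z, hz⟩ := finish n (dlcm n) 1 (s + 2 - i) s i (b i)
      (fun k hk => B_part s n b hb i hi hi2 k hk)
    refine ⟨z, ?_⟩
    rw [hz]
    simp
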